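/- arXiv:2006.16347 — 3 statements merged into one kernel-verified Lean document; each statement's English description precedes it below -/
import Mathlib

section
/- Let d ≥ 1, let ω : E^d → ℝ be an injective weight function, and let x ∈ ℤ^d. Since every vertex has out-degree exactly one in the directed nearest neighbor graph N_D, define x₀ = x and let x_{i+1} be the unique out-neighbor of x_i in N_D. Then exactly one of the following holds: either the vertices x₀, x₁, x₂, … are all distinct, or there is a least index i ≥ 2 such that x_i ∈ {x₀, …, x_{i−1}}, and in that case x_i = x_{i−2} (the forward orbit ends in a directed cycle of length two). -/
open MeasureTheory

/-- Vertices of the cubic lattice `ℤ^d`. -/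
abbrev Vd (d : ℕ) := Fin d → ℤ

/-- Lattice adjacency: `‖x - y‖₁ = 1`. -/
def latAdj {d : ℕ} (x y : Vd d) : Prop := (∑ i, |x i - y i|) = 1

/-- `e` is an edge of the cubic lattice. -/
def IsLatEdge {d : ℕ} (e : Sym2 (Vd d)) : Prop := ∃ x y : Vd d, latAdj x y ∧ e = s(x, y)

/-- The edge set `E^d` of the cubic lattice, as a type. -/
abbrev LatEdge (d : ℕ) := {e : Sym2 (Vd d) // IsLatEdge e}

/-- The configuration space `Ω = ℝ^{E^d}` (with the product Borel σ-algebra). -/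
abbrev Omega (d : ℕ) := LatEdge d → ℝ

/-- The lattice edge `{x, y}` determined by a pair of adjacent vertices. -/
def edgeOf {d : ℕ} {x y : Vd d} (h : latAdj x y) : LatEdge d := ⟨s(x, y), x, y, h, rfl⟩

open Classical in
/-- The weight `ω({x,y})` of the edge between adjacent `x` and `y` (junk value `0` otherwise). -/
noncomputable def wt {d : ℕ} (ω : Omega d) (x y : Vd d) : ℝ :=
  if h : latAdj x y then ω (edgeOf h) else 0

/-- `⟨x,y⟩` is a directed edge of the nearest neighbor graph `N_D`:
`{x,y} ∈ E^d` and `ω({x,y}) ≤ ω({x,z})` for every lattice neighbor `z` of `x`. -/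
def nnEdge {d : ℕ} (ω : Omega d) (x y : Vd d) : Prop :=
  latAdj x y ∧ ∀ z : Vd d, latAdj x z → wt ω x y ≤ wt ω x z

/-- The shift of the edge `e` by the lattice vector `z` : `e + z`. -/
def edgeShift {d : ℕ} (z : Vd d) (e : LatEdge d) : LatEdge d :=
  ⟨Sym2.map (· + z) e.1, by
    obtain ⟨x, y, hxy, he⟩ := e.2
    refine ⟨x + z, y + z, ?_, ?_⟩
    · simpa [latAdj, add_sub_add_right_eq_sub] using hxy
    · rw [he, Sym2.map_pair_eq]⟩

/-- The translation `T_z` on `Ω`: `(T_z ω)(e) = ω (e + z)`. -/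
def shiftT {d : ℕ} (z : Vd d) (ω : Omega d) : Omega d := fun e => ω (edgeShift z e)

/-- Assumption A: `P` is a translation invariant probability measure on `Ω`
with a.s. pairwise distinct weights. -/
def AssumptionA {d : ℕ} (P : Measure (Omega d)) : Prop :=
  IsProbabilityMeasure P ∧
  (∀ z : Vd d, P.map (shiftT z) = P) ∧
  ∀ e f : LatEdge d, e ≠ f → P {ω : Omega d | ω e = ω f} = 0

theorem latAdj_symm {d : ℕ} {x y : Vd d} (h : latAdj x y) : latAdj y x := by
  unfold latAdj at *
  simpa only [abs_sub_comm] using h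

theorem latAdj_ne {d : ℕ} {x y : Vd d} (h : latAdj x y) : x ≠ y := by
  rintro rfl
  simp [latAdj] at h

theorem wt_comm {d : ℕ} (ω : Omega d) {x y : Vd d} (h : latAdj x y) : wt ω x y = wt ω y x := by
  simp only [wt, h, latAdj_symm h, dite_true]
  exact congrArg ω (Subtype.ext Sym2.eq_swap)

/-- For injective weights, two edges at a vertex with the same weight coincide. -/
theorem eq_of_wt_eq {d : ℕ} {ω : Omega d} (hinj : Function.Injective ω) {x y z : Vd d}
    (hy : latAdj x y) (hz : latAdj x z) (h : wt ω x y = wt ω x z) : y = z := by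
  simp only [wt, hy, hz, dite_true] at h
  exact Sym2.congr_right.mp (congrArg Subtype.val (hinj h))

/-- For injective weights, the out-neighbor in the nearest neighbor graph is unique. -/
theorem nnEdge_unique {d : ℕ} {ω : Omega d} (hinj : Function.Injective ω) {x y z : Vd d}
    (hy : nnEdge ω x y) (hz : nnEdge ω x z) : y = z :=
  eq_of_wt_eq hinj hy.1 hz.1 (le_antisymm (hy.2 z hz.1) (hz.2 y hy.1))

/-- The weights along a forward orbit are nonincreasing. -/
theorem antitone_wt_orbit {d : ℕ} {ω : Omega d} {f : ℕ → Vd d}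
    (hstep : ∀ i, nnEdge ω (f i) (f (i + 1))) : Antitone fun i => wt ω (f i) (f (i + 1)) :=
  antitone_nat_of_succ_le fun i =>
    ((hstep (i + 1)).2 _ (latAdj_symm (hstep i).1)).trans_eq (wt_comm ω (hstep i).1).symm

/-- A forward orbit which returns to a vertex does so after two steps. -/
theorem orbit_add_two_eq {d : ℕ} {ω : Omega d} (hinj : Function.Injective ω) {f : ℕ → Vd d}
    (hstep : ∀ i, nnEdge ω (f i) (f (i + 1))) {i j : ℕ} (hji : j < i) (h : f i = f j) :
    f (j + 2) = f j := by
  have hsucc : f (i + 1) = f (j + 1) := nnEdge_unique hinj (hstep i) (h ▸ hstep j)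
  have hanti := antitone_wt_orbit hstep
  have h₁ : wt ω (f (j + 1)) (f (j + 2)) ≤ wt ω (f j) (f (j + 1)) := hanti (Nat.le_succ j)
  have h₂ : wt ω (f i) (f (i + 1)) ≤ wt ω (f (j + 1)) (f (j + 2)) := hanti hji
  rw [h, hsucc] at h₂
  have hadj := (hstep j).1
  exact eq_of_wt_eq hinj (hstep (j + 1)).1 (latAdj_symm hadj)
    ((le_antisymm h₁ h₂).trans (wt_comm ω hadj))

/-- **Lemma (structure of forward orbits).** For injective weights, let `f` be the forward
orbit of a vertex under the (out-degree one) nearest neighbor map.  Then exactly one of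
the following holds: either all the `f i` are distinct, or there is a least index
`i ≥ 2` such that `f i ∈ {f 0, …, f (i-1)}`, and in that case `f i = f (i-2)`. -/
theorem forward_orbit_dichotomy (d : ℕ) (hd : 1 ≤ d)
    (ω : Omega d) (hinj : Function.Injective ω)
    (f : ℕ → Vd d) (hstep : ∀ i, nnEdge ω (f i) (f (i + 1))) :
    Xor' (∀ i j, i < j → f i ≠ f j)
      (∃ i, 2 ≤ i ∧ (∃ j < i, f i = f j) ∧
        (∀ m, (∃ j < m, f m = f j) → i ≤ m) ∧ f i = f (i - 2)) := by
  classical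
  by_cases hdist : ∀ i j, i < j → f i ≠ f j
  · refine Or.inl ⟨hdist, ?_⟩
    rintro ⟨i, -, ⟨j, hji, h⟩, -⟩
    exact hdist j i hji h.symm
  · refine Or.inr ⟨?_, hdist⟩
    push Not at hdist
    have hex : ∃ m, ∃ j < m, f m = f j :=
      let ⟨j, i, hji, h⟩ := hdist
      ⟨i, j, hji, h.symm⟩
    obtain ⟨j, hji, h⟩ := Nat.find_spec hex
    have hmin : ∀ m, (∃ j < m, f m = f j) → Nat.find hex ≤ m := fun m hm => Nat.find_min' hex hm
    have hle : Nat.find hex ≤ j + 2 :=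
      hmin _ ⟨j, by omega, orbit_add_two_eq hinj hstep hji h⟩
    have hne : Nat.find hex ≠ j + 1 := fun heq => latAdj_ne (hstep j).1 (heq ▸ h).symm
    have heq : Nat.find hex = j + 2 := by omega
    rw [heq] at h hmin
    exact ⟨j + 2, by omega, ⟨j, by omega, h⟩, hmin, h⟩
end

section
/- Let d ≥ 1 and let ℙ be a probability measure on Ω = ℝ^{E^d} satisfying assumption A. Then ℙ-almost surely, for every x ∈ ℤ^d: if the subgraph Γ_x of N_D induced by the vertices y with a directed path from x to y is finite, then the subgraph C_x induced by the vertices y with a directed path from y to x is also finite. -/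
open MeasureTheory

section Relation

open Relation

/-- Reachability inherits measurability from a random relation on a countable type. -/
lemma measurableSet_reflTransGen {Ω V : Type*} [MeasurableSpace Ω] [Countable V]
    {r : Ω → V → V → Prop} (hr : ∀ a b, MeasurableSet {ω | r ω a b}) (a b : V) :
    MeasurableSet {ω | ReflTransGen (r ω) a b} := by
  let s : ℕ → V → Set Ω := fun n => Nat.rec (fun c => {_ω | a = c})
    (fun _ p c => ⋃ u, p u ∩ {ω | r ω u c}) n
  have hs : ∀ n c, MeasurableSet (s n c) := by
    intro n
    induction n with
    | zero => exact fun c => MeasurableSet.const _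
    | succ n ih => exact fun c => .iUnion fun u => (ih u).inter (hr u c)
  suffices {ω | ReflTransGen (r ω) a b} = ⋃ n, s n b from
    this ▸ .iUnion fun n => hs n b
  ext ω
  simp only [Set.mem_ofPred_eq, Set.mem_iUnion]
  constructor
  · intro h
    induction h with
    | refl => exact ⟨0, rfl⟩
    | tail _ hbc ih =>
      obtain ⟨n, hn⟩ := ih
      exact ⟨n + 1, Set.mem_iUnion.2 ⟨_, hn, hbc⟩⟩
  · rintro ⟨n, hn⟩
    induction n generalizing b with
    | zero => cases (show a = b from hn); exact .refl
    | succ n ih =>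
      obtain ⟨u, hu, hub⟩ := Set.mem_iUnion.1 hn
      exact (ih u hu).tail hub

/-- At most `k` vertices are reachable from `y`. -/
def ForwardCardLE {V : Type*} (r : V → V → Prop) (k : ℕ) (y : V) : Prop :=
  ∀ T : Finset V, (∀ t ∈ T, ReflTransGen r y t) → T.card ≤ k

/-- When out-degrees are at most one, at most `k` of the vertices reachable from `x`
have a forward cluster of size at most `k`. -/
lemma card_le_of_forall_forwardCardLE {V : Type*} {r : V → V → Prop}
    (hr : Relator.RightUnique r) {k : ℕ} {x : V} (T : Finset V)
    (hT : ∀ t ∈ T, ReflTransGen r x t ∧ ForwardCardLE r k t) : T.card ≤ k := by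
  classical
  rcases T.eq_empty_or_nonempty with rfl | hne
  · simp
  obtain ⟨y, hy, hreach⟩ : ∃ y ∈ T, ∀ t ∈ T, ReflTransGen r y t := by
    have hx : ∀ t ∈ T, ReflTransGen r x t := fun t ht => (hT t ht).1
    clear hT
    induction hne using Finset.Nonempty.cons_induction with
    | singleton a => exact ⟨a, by simp, by simp [ReflTransGen.refl]⟩
    | cons a s has hs ih =>
      obtain ⟨y, hy, hreach⟩ := ih fun t ht => hx t (by simp [ht])
      rcases ReflTransGen.total_of_right_unique hr (hx a (by simp)) (hx y (by simp [hy]))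
        with h | h
      · refine ⟨a, by simp, fun t ht => ?_⟩
        rcases Finset.mem_cons.1 ht with rfl | ht
        · exact .refl
        · exact h.trans (hreach t ht)
      · refine ⟨y, by simp [hy], fun t ht => ?_⟩
        rcases Finset.mem_cons.1 ht with rfl | ht
        · exact h
        · exact hreach t ht
  exact (hT y hy).2 T hreach

lemma exists_forwardCardLE {V : Type*} {r : V → V → Prop} {y : V}
    (h : {t | ReflTransGen r y t}.Finite) : ∃ k, ForwardCardLE r k y :=
  ⟨h.toFinset.card, fun _ hT => Finset.card_le_card fun t ht => h.mem_toFinset.2 (hT t ht)⟩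

end Relation

section Measure

/-- If almost surely at most `k` of the events `s i` occur, then `∑ μ (s i) ≤ k`. -/
lemma tsum_measure_le_of_card_le {Ω ι : Type*} [MeasurableSpace Ω] {μ : Measure Ω}
    [IsProbabilityMeasure μ] {s : ι → Set Ω} (hs : ∀ i, MeasurableSet (s i)) {k : ℕ}
    (h : ∀ᵐ ω ∂μ, ∀ T : Finset ι, (∀ i ∈ T, ω ∈ s i) → T.card ≤ k) :
    ∑' i, μ (s i) ≤ k := by
  classical
  refine ENNReal.summable.tsum_le_of_sum_le fun T => ?_
  calc ∑ i ∈ T, μ (s i) = ∫⁻ ω, ∑ i ∈ T, (s i).indicator 1 ω ∂μ := by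
        rw [lintegral_finsetSum _ fun i _ => measurable_one.indicator (hs i)]
        simp [hs]
    _ ≤ ∫⁻ _, (k : ENNReal) ∂μ := by
        refine lintegral_mono_ae (h.mono fun ω hω => ?_)
        have hcard := hω (T.filter fun i => ω ∈ s i) fun i hi => (Finset.mem_filter.1 hi).2
        simpa [Set.indicator_apply, Finset.sum_boole] using hcard
    _ = k := by simp

end Measure

section Lattice

open Relation

variable {d : ℕ}

lemma latAdj_add_right (x y z : Vd d) : latAdj (x + z) (y + z) ↔ latAdj x y := by
  simp [latAdj]

lemma wt_shiftT (z : Vd d) (ω : Omega d) (x y : Vd d) :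
    wt (shiftT z ω) x y = wt ω (x + z) (y + z) := by
  by_cases h : latAdj x y
  · rw [wt, wt, dif_pos h, dif_pos ((latAdj_add_right x y z).2 h)]
    rfl
  · rw [wt, wt, dif_neg h, dif_neg (mt (latAdj_add_right x y z).1 h)]

lemma nnEdge_shiftT (z : Vd d) (ω : Omega d) (x y : Vd d) :
    nnEdge (shiftT z ω) x y ↔ nnEdge ω (x + z) (y + z) := by
  simp only [nnEdge, wt_shiftT, latAdj_add_right]
  refine and_congr_right fun _ => (Equiv.addRight z).forall_congr fun w => ?_
  simp [latAdj_add_right]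

lemma reflTransGen_nnEdge_shiftT (z : Vd d) (ω : Omega d) (x y : Vd d) :
    ReflTransGen (nnEdge (shiftT z ω)) x y ↔ ReflTransGen (nnEdge ω) (x + z) (y + z) := by
  constructor
  · exact fun h => h.lift (· + z) fun a b => (nnEdge_shiftT z ω a b).1
  · intro h
    simpa [Function.onFun] using h.lift (p := nnEdge (shiftT z ω)) (· - z) fun a b hab =>
      (nnEdge_shiftT z ω _ _).2 (by simpa using hab)

lemma forwardCardLE_nnEdge_shiftT (z : Vd d) (ω : Omega d) (k : ℕ) (y : Vd d) :
    ForwardCardLE (nnEdge (shiftT z ω)) k y ↔ ForwardCardLE (nnEdge ω) k (y + z) := by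
  simp only [ForwardCardLE, reflTransGen_nnEdge_shiftT]
  refine (Equiv.addRight z).finsetCongr.forall_congr fun T => ?_
  simp [-Finset.mem_map_equiv]

lemma measurable_shiftT (z : Vd d) : Measurable (shiftT (d := d) z) :=
  measurable_pi_iff.2 fun _ => measurable_pi_apply _

lemma measurable_wt (x y : Vd d) : Measurable fun ω : Omega d => wt ω x y := by
  unfold wt
  split_ifs
  · exact measurable_pi_apply _
  · exact measurable_const

lemma measurableSet_nnEdge (x y : Vd d) : MeasurableSet {ω : Omega d | nnEdge ω x y} := by
  simp only [nnEdge, Set.ofPred_and, Set.ofPred_forall]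
  exact (MeasurableSet.const _).inter <| .iInter fun z => .iInter fun _ =>
    measurableSet_le (measurable_wt x y) (measurable_wt x z)

/-- The event that `y` is reachable from `x` and has a forward cluster of size at most `k`. -/
def reachEvent (k : ℕ) (x y : Vd d) : Set (Omega d) :=
  {ω | ReflTransGen (nnEdge ω) x y ∧ ForwardCardLE (nnEdge ω) k y}

lemma measurableSet_reachEvent (k : ℕ) (x y : Vd d) : MeasurableSet (reachEvent k x y) := by
  have hreach := measurableSet_reflTransGen (measurableSet_nnEdge (d := d))
  refine (hreach x y).inter ?_
  change MeasurableSet {ω | ForwardCardLE (nnEdge ω) k y}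
  simp only [ForwardCardLE, Set.ofPred_forall]
  refine .iInter fun T => ?_
  have hT : MeasurableSet {ω : Omega d | ∀ t ∈ T, ReflTransGen (nnEdge ω) y t} := by
    simp only [Set.ofPred_forall]
    exact .iInter fun t => .iInter fun _ => hreach y t
  exact hT.imp (MeasurableSet.const _)

lemma measure_reachEvent_add {P : Measure (Omega d)} (hP : ∀ z, P.map (shiftT z) = P)
    (k : ℕ) (x y z : Vd d) : P (reachEvent k (x + z) (y + z)) = P (reachEvent k x y) := by
  conv_rhs => rw [← hP z, Measure.map_apply (measurable_shiftT z) (measurableSet_reachEvent k x y)]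
  congr 1
  ext ω
  simp [reachEvent, reflTransGen_nnEdge_shiftT, forwardCardLE_nnEdge_shiftT]

/-- Mass transport: incoming and outgoing mass have the same expectation. -/
lemma tsum_measure_reachEvent {P : Measure (Omega d)} (hP : ∀ z, P.map (shiftT z) = P)
    (k : ℕ) (y : Vd d) :
    ∑' x, P (reachEvent k x y) = ∑' x, P (reachEvent k y x) := by
  rw [← (Equiv.subLeft (y + y)).tsum_eq fun x => P (reachEvent k y x)]
  refine tsum_congr fun x => ?_
  rw [← measure_reachEvent_add hP k x y (y - x)]
  simp [add_sub_assoc]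

lemma rightUnique_nnEdge {ω : Omega d} (hω : Function.Injective ω) :
    Relator.RightUnique (nnEdge ω) := by
  intro x y z hy hz
  have h : wt ω x y = wt ω x z := le_antisymm (hy.2 z hz.1) (hz.2 y hy.1)
  simp only [wt, dif_pos hy.1, dif_pos hz.1] at h
  exact Sym2.congr_right.1 (congrArg Subtype.val (hω h))

lemma ae_injective {P : Measure (Omega d)}
    (hP : ∀ e f : LatEdge d, e ≠ f → P {ω : Omega d | ω e = ω f} = 0) :
    ∀ᵐ ω ∂P, Function.Injective ω := by
  have : Countable (LatEdge d) := by
    have : Countable (Sym2 (Vd d)) := Quotient.countable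
    infer_instance
  have h : ∀ᵐ ω ∂P, ∀ e f : LatEdge d, e ≠ f → ω e ≠ ω f := by
    simp only [ae_all_iff]
    intro e f hef
    simpa [ae_iff] using hP e f hef
  exact h.mono fun ω hω e f hef => by_contra fun hne => hω e f hne hef

end Lattice

/-- **Lemma.** Under assumption A, almost surely, for every `x ∈ ℤ^d`: if the forward
cluster `Γ_x` (vertices reachable from `x` in `N_D`) is finite, then the backward cluster
`C_x` (vertices from which `x` is reachable in `N_D`) is also finite. -/
theorem backward_finite_of_forward_finite (d : ℕ) (hd : 1 ≤ d)
    (P : Measure (Omega d)) (hP : AssumptionA P) :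
    ∀ᵐ ω ∂P, ∀ x : Vd d,
      {y : Vd d | Relation.ReflTransGen (nnEdge ω) x y}.Finite →
      {y : Vd d | Relation.ReflTransGen (nnEdge ω) y x}.Finite := by
  obtain ⟨_, hshift, hdist⟩ := hP
  have hfin : ∀ᵐ ω ∂P, ∀ (k : ℕ) (x : Vd d), {y | ω ∈ reachEvent k y x}.Finite := by
    simp only [ae_all_iff]
    intro k x
    refine ae_finite_setOfPred_mem (ne_top_of_le_ne_top (ENNReal.natCast_ne_top k) ?_)
    rw [tsum_measure_reachEvent hshift]
    refine tsum_measure_le_of_card_le (measurableSet_reachEvent k x) ?_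
    filter_upwards [ae_injective hdist] with ω hω T hT
    exact card_le_of_forall_forwardCardLE (rightUnique_nnEdge hω) T hT
  filter_upwards [hfin] with ω hω x hx
  obtain ⟨k, hk⟩ := exists_forwardCardLE hx
  exact (hω k x).subset fun y hy => ⟨hy, hk⟩
end

section
/- Let V ⊆ ℤ² be site-connected and infinite. Then the dual edge boundary graph B(V) contains no vertex self-avoiding circuit; consequently B(V) is a vertex-disjoint union of vertex self-avoiding doubly-infinite paths. -/
/-- `x` and `y` are site-neighbors in `ℤ²`: `‖x − y‖₁ = 1`. -/
def siteAdj (x y : ℤ × ℤ) : Prop := |x.1 - y.1| + |x.2 - y.2| = 1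

/-- `x` and `y` are joined by a path of site-neighbors remaining in `W`. -/
def connIn (W : Set (ℤ × ℤ)) (x y : ℤ × ℤ) : Prop :=
  Relation.ReflTransGen (fun a b => siteAdj a b ∧ a ∈ W ∧ b ∈ W) x y

/-- The site-component of `W` containing `x` (for `x ∈ W`). -/
def siteComp (W : Set (ℤ × ℤ)) (x : ℤ × ℤ) : Set (ℤ × ℤ) := {y | connIn W x y}

/-- The closure `V̄` of `V`: the union of `V` with all finite site-components of `Vᶜ`. -/
def clo (V : Set (ℤ × ℤ)) : Set (ℤ × ℤ) :=
  V ∪ {x | x ∉ V ∧ (siteComp Vᶜ x).Finite}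

/-- `a` and `b` (dual vertices, where `w` stands for the point `w + (1/2, 1/2)`) are
joined by an edge of the dual edge boundary `B(V)`: they are dual neighbors and the
unique primal edge `{x, y}` bisected by the dual edge `{a, b}` (characterized by
`siteAdj x y` and `x + y = a + b + (1,1)`) has `x ∈ V̄` and `y ∉ V̄`. -/
def dualBdryAdj (V : Set (ℤ × ℤ)) (a b : ℤ × ℤ) : Prop :=
  siteAdj a b ∧ ∃ x y : ℤ × ℤ, siteAdj x y ∧ x + y = a + b + (1, 1) ∧
    x ∈ clo V ∧ y ∉ clo V

theorem siteAdj_iff {a b : ℤ × ℤ} : siteAdj a b ↔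
    (b.1 = a.1 + 1 ∧ b.2 = a.2) ∨ (b.1 = a.1 - 1 ∧ b.2 = a.2) ∨
      (b.1 = a.1 ∧ b.2 = a.2 + 1) ∨ (b.1 = a.1 ∧ b.2 = a.2 - 1) := by
  unfold siteAdj
  rcases abs_cases (a.1 - b.1) with h | h <;> rcases abs_cases (a.2 - b.2) with h' | h' <;> omega

theorem siteAdj_symm {a b : ℤ × ℤ} (h : siteAdj a b) : siteAdj b a := by
  rw [siteAdj_iff] at *; omega

/-- The signed crossing of the step from `a` to `b` with the horizontal ray that starts at
`P - (1/2, 1/2)` and points to the right. -/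
def rayCrossing (P a b : ℤ × ℤ) : ℤ :=
  if P.1 ≤ a.1 ∧ a.2 = P.2 - 1 ∧ b.2 = P.2 then 1
  else if P.1 ≤ a.1 ∧ b.2 = P.2 - 1 ∧ a.2 = P.2 then -1 else 0

theorem exists_potential_of_siteAdj {P Q : ℤ × ℤ} (hPQ : siteAdj P Q) :
    ∃ φ : ℤ × ℤ → ℤ, ∀ a b, siteAdj a b →
      (P + Q ≠ a + b + (1, 1) → rayCrossing P a b - rayCrossing Q a b = φ b - φ a) ∧
      (P + Q = a + b + (1, 1) → rayCrossing P a b - rayCrossing Q a b ≠ φ b - φ a) := by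
  obtain ⟨p, q⟩ := P
  obtain ⟨p', q'⟩ := Q
  rw [siteAdj_iff] at hPQ
  simp only at hPQ
  refine ⟨fun v => if p' = p ∧ v.2 = min q q' ∧ p ≤ v.1 then q' - q
    else 0, ?_⟩
  rintro ⟨a, a'⟩ ⟨b, b'⟩ hab
  rw [siteAdj_iff] at hab
  simp only [rayCrossing, Prod.mk_add_mk, ne_eq, Prod.mk.injEq] at *
  rcases hPQ with ⟨rfl, rfl⟩ | ⟨rfl, rfl⟩ | ⟨rfl, rfl⟩ | ⟨rfl, rfl⟩ <;>
    rcases hab with ⟨rfl, rfl⟩ | ⟨rfl, rfl⟩ | ⟨rfl, rfl⟩ | ⟨rfl, rfl⟩ <;>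
    constructor <;> intro _ <;> split_ifs <;> omega

theorem exists_coord_bound (γ : ℕ → ℤ × ℤ) (k : ℕ) :
    ∃ N : ℤ, ∀ i ≤ k, -N ≤ (γ i).1 ∧ (γ i).1 ≤ N ∧ -N ≤ (γ i).2 ∧ (γ i).2 ≤ N := by
  induction k with
  | zero =>
    refine ⟨|(γ 0).1| + |(γ 0).2|, fun i hi => ?_⟩
    obtain rfl : i = 0 := by omega
    rcases abs_cases (γ 0).1 with h | h <;> rcases abs_cases (γ 0).2 with h' | h' <;> omega
  | succ k ih =>
    obtain ⟨N, hN⟩ := ih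
    refine ⟨|N| + |(γ (k + 1)).1| + |(γ (k + 1)).2|, fun i hi => ?_⟩
    rcases abs_cases N with h₀ | h₀ <;> rcases abs_cases (γ (k + 1)).1 with h | h <;>
      rcases abs_cases (γ (k + 1)).2 with h' | h' <;>
      rcases Nat.lt_or_ge i (k + 1) with h₁ | h₁ <;>
      first
      | (have := hN i (by omega); omega)
      | (obtain rfl : i = k + 1 := by omega
         omega)

/-- A closed walk of site-neighbors has a finitely supported winding function on the faces,
which changes exactly across the edges of the walk that are used once (and possibly across
those used several times). The face with centre `P - (1/2, 1/2)` is represented by `P`. -/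
theorem exists_winding (k : ℕ) (γ : ℕ → ℤ × ℤ) (hγ : ∀ i < k, siteAdj (γ i) (γ (i + 1)))
    (hclosed : γ k = γ 0) :
    ∃ g : ℤ × ℤ → ℤ, {P | g P ≠ 0}.Finite ∧
      (∀ P Q, siteAdj P Q → (∀ i < k, P + Q ≠ γ i + γ (i + 1) + (1, 1)) → g P = g Q) ∧
      (∀ P Q, siteAdj P Q → ∀ j < k, P + Q = γ j + γ (j + 1) + (1, 1) →
        (∀ i < k, i ≠ j → P + Q ≠ γ i + γ (i + 1) + (1, 1)) → g P ≠ g Q) := by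
  have key : ∀ (P Q : ℤ × ℤ) (φ : ℤ × ℤ → ℤ),
      (∑ i ∈ Finset.range k, rayCrossing P (γ i) (γ (i + 1))) -
        (∑ i ∈ Finset.range k, rayCrossing Q (γ i) (γ (i + 1))) =
      ∑ i ∈ Finset.range k, (rayCrossing P (γ i) (γ (i + 1)) -
        rayCrossing Q (γ i) (γ (i + 1)) - (φ (γ (i + 1)) - φ (γ i))) := by
    intro P Q φ
    rw [Finset.sum_sub_distrib, Finset.sum_range_sub (fun i => φ (γ i)), hclosed,
      Finset.sum_sub_distrib]
    ring
  refine ⟨fun P => ∑ i ∈ Finset.range k, rayCrossing P (γ i) (γ (i + 1)), ?_, ?_, ?_⟩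
  · obtain ⟨N, hN⟩ := exists_coord_bound γ k
    refine (Set.finite_Icc (-N, -N) (N + 1, N + 1)).subset fun P hP => ?_
    by_contra hout
    simp only [Set.mem_Icc, Prod.le_def] at hout
    apply hP
    by_cases hleft : P.1 < -N
    · have hstep : ∀ i ∈ Finset.range k, rayCrossing P (γ i) (γ (i + 1)) =
          (if P.2 ≤ (γ (i + 1)).2 then 1 else 0) - (if P.2 ≤ (γ i).2 then 1 else 0) := by
        intro i hi
        have hi := Finset.mem_range.1 hi
        have h₁ := hN i hi.le
        have h₂ := siteAdj_iff.1 (hγ i hi)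
        unfold rayCrossing
        split_ifs <;> omega
      change ∑ i ∈ Finset.range k, rayCrossing P (γ i) (γ (i + 1)) = 0
      rw [Finset.sum_congr rfl hstep,
        Finset.sum_range_sub (fun i => if P.2 ≤ (γ i).2 then (1 : ℤ) else 0), hclosed, sub_self]
    · refine Finset.sum_eq_zero fun i hi => ?_
      have hi := Finset.mem_range.1 hi
      have h₁ := hN i hi.le
      have h₂ := hN (i + 1) hi
      unfold rayCrossing
      split_ifs <;> omega
  · intro P Q hPQ hno
    obtain ⟨φ, hφ⟩ := exists_potential_of_siteAdj hPQ
    rw [← sub_eq_zero, key P Q φ]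
    refine Finset.sum_eq_zero fun i hi => ?_
    have hi := Finset.mem_range.1 hi
    rw [(hφ _ _ (hγ i hi)).1 (hno i hi), sub_self]
  · intro P Q hPQ j hj hjeq hno
    obtain ⟨φ, hφ⟩ := exists_potential_of_siteAdj hPQ
    rw [← sub_ne_zero, key P Q φ, Finset.sum_eq_single_of_mem j (Finset.mem_range.2 hj)]
    · exact sub_ne_zero.2 ((hφ _ _ (hγ j hj)).2 hjeq)
    · intro i hi hij
      have hi := Finset.mem_range.1 hi
      rw [(hφ _ _ (hγ i hi)).1 (hno i hi hij), sub_self]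

theorem connIn_symm {W : Set (ℤ × ℤ)} {x y : ℤ × ℤ} (h : connIn W x y) : connIn W y x := by
  unfold connIn at *
  induction h with
  | refl => exact .refl
  | tail _ hbc ih => exact .head ⟨siteAdj_symm hbc.1, hbc.2.2, hbc.2.1⟩ ih

/-- A finitely supported function that is constant along the edges inside `W` vanishes at
every point whose site-component in `W` is infinite. -/
theorem eq_zero_of_infinite_siteComp {W : Set (ℤ × ℤ)} {h : ℤ × ℤ → ℤ}
    (hfin : {x | h x ≠ 0}.Finite)
    (hconst : ∀ x y, siteAdj x y → x ∈ W → y ∈ W → h x = h y) {x : ℤ × ℤ}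
    (hx : (siteComp W x).Infinite) : h x = 0 := by
  by_contra hne
  refine hx (hfin.subset fun y hy => ?_)
  have : h x = h y := by
    change connIn W x y at hy
    unfold connIn at hy
    induction hy with
    | refl => rfl
    | tail _ hbc ih => exact ih.trans (hconst _ _ hbc.1 hbc.2.1 hbc.2.2)
  change h y ≠ 0
  rwa [← this]

theorem notMem_clo_iff {V : Set (ℤ × ℤ)} {x : ℤ × ℤ} :
    x ∉ clo V ↔ x ∉ V ∧ (siteComp Vᶜ x).Infinite := by
  simp only [clo, Set.mem_union, Set.mem_ofPred_eq, Set.Infinite]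
  tauto

theorem siteComp_subset_of_connIn {W : Set (ℤ × ℤ)} {x y : ℤ × ℤ} (h : connIn W x y) :
    siteComp W y ⊆ siteComp W x :=
  fun _ hz => Relation.ReflTransGen.trans h hz

theorem mem_clo_iff_of_siteAdj {V : Set (ℤ × ℤ)} {x y : ℤ × ℤ} (hxy : siteAdj x y)
    (hx : x ∉ V) (hy : y ∉ V) : x ∈ clo V ↔ y ∈ clo V := by
  have h : connIn Vᶜ x y := .single ⟨hxy, hx, hy⟩
  simp only [clo, Set.mem_union, Set.mem_ofPred_eq, hx, hy, not_false_eq_true, true_and, false_or]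
  exact ⟨fun hf => hf.subset (siteComp_subset_of_connIn h),
    fun hf => hf.subset (siteComp_subset_of_connIn (connIn_symm h))⟩

theorem mem_of_mem_clo_of_siteAdj {V : Set (ℤ × ℤ)} {x y : ℤ × ℤ} (hxy : siteAdj x y)
    (hx : x ∈ clo V) (hy : y ∉ clo V) : x ∈ V := by
  by_contra hxV
  exact hy ((mem_clo_iff_of_siteAdj hxy hxV (notMem_clo_iff.1 hy).1).1 hx)

theorem eq_or_eq_of_add_eq_add {x y x' y' : ℤ × ℤ} (h : siteAdj x y) (h' : siteAdj x' y')
    (hs : x + y = x' + y') : (x = x' ∧ y = y') ∨ (x = y' ∧ y = x') := by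
  rw [siteAdj_iff] at h h'
  simp only [Prod.ext_iff, Prod.fst_add, Prod.snd_add] at *
  omega

theorem dualBdryAdj_symm {V : Set (ℤ × ℤ)} {a b : ℤ × ℤ} (h : dualBdryAdj V a b) :
    dualBdryAdj V b a := by
  obtain ⟨hab, x, y, hxy, hs, hx, hy⟩ := h
  exact ⟨siteAdj_symm hab, x, y, hxy, by rw [hs, add_comm a b], hx, hy⟩

theorem dualBdryAdj_iff {V : Set (ℤ × ℤ)} {a b x y : ℤ × ℤ} (hab : siteAdj a b)
    (hxy : siteAdj x y) (hs : x + y = a + b + (1, 1)) :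
    dualBdryAdj V a b ↔ ¬ (x ∈ clo V ↔ y ∈ clo V) := by
  constructor
  · rintro ⟨-, x', y', hxy', hs', hx', hy'⟩
    rcases eq_or_eq_of_add_eq_add hxy hxy' (hs.trans hs'.symm) with ⟨rfl, rfl⟩ | ⟨rfl, rfl⟩ <;>
      tauto
  · intro h
    by_cases hx : x ∈ clo V
    · exact ⟨hab, x, y, hxy, hs, hx, by tauto⟩
    · exact ⟨hab, y, x, siteAdj_symm hxy, by rw [add_comm, hs],
        by_contra fun hy => h (iff_of_false hx hy), hx⟩

theorem not_exists_dualBdry_circuit {V : Set (ℤ × ℤ)} (hinf : V.Infinite)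
    (hconn : ∀ x ∈ V, ∀ y ∈ V, connIn V x y) :
    ¬ ∃ (k : ℕ) (γ : ℕ → ℤ × ℤ), 3 ≤ k ∧
        (∀ i < k, dualBdryAdj V (γ i) (γ (i + 1))) ∧
        (∀ i j, i < j → j < k → γ i ≠ γ j) ∧ γ k = γ 0 := by
  rintro ⟨k, γ, hk, hadj, hinj, hclosed⟩
  obtain ⟨g, hfin, hconst, hjump⟩ := exists_winding k γ (fun i hi => (hadj i hi).1) hclosed
  have hsame : ∀ P Q, siteAdj P Q → (P ∈ clo V ↔ Q ∈ clo V) → g P = g Q := by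
    intro P Q hPQ hiff
    refine hconst P Q hPQ fun i hi hs => ?_
    exact (dualBdryAdj_iff (hadj i hi).1 hPQ hs).1 (hadj i hi) hiff
  obtain ⟨-, x, y, hxy, hs, hx, hy⟩ := hadj 0 (by omega)
  have hxV := mem_of_mem_clo_of_siteAdj hxy hx hy
  have hgx : g x = 0 := by
    refine eq_zero_of_infinite_siteComp (W := V) hfin (fun P Q hPQ hP hQ => ?_)
      (hinf.mono fun z hz => hconn x hxV z hz)
    exact hsame P Q hPQ (iff_of_true (Or.inl hP) (Or.inl hQ))
  have hgy : g y = 0 := by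
    refine eq_zero_of_infinite_siteComp (W := Vᶜ) hfin (fun P Q hPQ hP hQ => ?_)
      (notMem_clo_iff.1 hy).2
    exact hsame P Q hPQ (mem_clo_iff_of_siteAdj hPQ hP hQ)
  refine hjump x y hxy 0 (by omega) hs ?_ (hgx.trans hgy.symm)
  intro i hi hi0 hs'
  have hs'' : γ 0 + γ (0 + 1) = γ i + γ (i + 1) := add_right_cancel (hs.symm.trans hs')
  rcases eq_or_eq_of_add_eq_add (hadj 0 (by omega)).1 (hadj i hi).1 hs'' with ⟨h, -⟩ | ⟨h, h'⟩
  · exact hinj 0 i (by omega) hi h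
  · rcases Nat.lt_or_ge 1 i with hi1 | hi1
    · exact hinj 1 i hi1 hi h'
    · obtain rfl : i = 1 := by omega
      exact hinj 0 2 (by omega) (by omega) h

theorem exists_seq_of_reflTransGen {α : Type*} {r : α → α → Prop} {a b : α}
    (h : Relation.ReflTransGen r a b) :
    ∃ (n : ℕ) (p : ℕ → α), p 0 = a ∧ p n = b ∧ ∀ i < n, r (p i) (p (i + 1)) := by
  induction h with
  | refl => exact ⟨0, fun _ => a, rfl, rfl, by simp⟩
  | @tail b c _ hbc ih =>
    obtain ⟨n, p, h0, hn, hp⟩ := ih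
    refine ⟨n + 1, fun i => if i ≤ n then p i else c, by simpa using h0, by simp, ?_⟩
    intro i hi
    rcases Nat.lt_or_ge i n with h | h
    · simpa [h.le, Nat.succ_le_of_lt h] using hp i h
    · obtain rfl : i = n := by omega
      simpa [hn] using hbc

/-- Around a face, a site-connected set `V` and its complement cannot alternate if both of the
complementary corners lie in infinite site-components of the complement. -/
theorem not_alternating {V : Set (ℤ × ℤ)} (hconn : ∀ x ∈ V, ∀ y ∈ V, connIn V x y)
    {σ τ : ℤ} (hσ : (σ = 1 ∧ τ = 1) ∨ (σ = -1 ∧ τ = 0)) (A : ℤ × ℤ)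
    (hA : A ∈ V) (hC : A + (σ, 1) ∈ V) (hB : A + (σ, 0) ∉ V) (hD : A + (0, 1) ∉ V)
    (hB' : (siteComp Vᶜ (A + (σ, 0))).Infinite) (hD' : (siteComp Vᶜ (A + (0, 1))).Infinite) :
    False := by
  obtain ⟨n, p, hp0, hpn, hp⟩ := exists_seq_of_reflTransGen (hconn A hA _ hC)
  let γ : ℕ → ℤ × ℤ := fun i => if i ≤ n then p i else if i = n + 1 then A + (σ, 0) else A
  have hstep : ∀ i < n + 2, (siteAdj (γ i) (γ (i + 1)) ∧ γ i ∈ V ∧ γ (i + 1) ∈ V) ∨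
      (i = n ∧ γ i = A + (σ, 1) ∧ γ (i + 1) = A + (σ, 0)) ∨
      (i = n + 1 ∧ γ i = A + (σ, 0) ∧ γ (i + 1) = A) := by
    intro i hi
    rcases Nat.lt_or_ge i n with h | h
    · left
      simpa [γ, h.le, Nat.succ_le_of_lt h] using hp i h
    · rcases Nat.eq_or_lt_of_le h with h | h
      · subst h
        simp [γ, hpn]
      · obtain rfl : i = n + 1 := by omega
        simp [γ]
  have hwalk : ∀ i < n + 2, siteAdj (γ i) (γ (i + 1)) := by
    intro i hi
    rcases hstep i hi with h | ⟨-, h, h'⟩ | ⟨-, h, h'⟩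
    · exact h.1
    · rw [h, h', siteAdj_iff]; simp
    · rw [h, h', siteAdj_iff]; simp; omega
  have hclosed : γ (n + 2) = γ 0 := by simp [γ, hp0]
  obtain ⟨g, hfin, hconst, hjump⟩ := exists_winding (n + 2) γ hwalk hclosed
  -- An edge with an endpoint outside `V` is crossed only next to `A + (σ, 0)`.
  have hcross : ∀ u v, siteAdj u v → u ∉ V →
      ¬ (u = A + (σ, 0) ∧ (v = A ∨ v = A + (σ, 1))) →
      ∀ i < n + 2, u + v ≠ γ i + γ (i + 1) := by
    intro u v huv hu hne i hi hs
    rcases eq_or_eq_of_add_eq_add huv (hwalk i hi) hs with ⟨h₁, h₂⟩ | ⟨h₁, h₂⟩ <;>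
      rcases hstep i hi with h | ⟨-, h, h'⟩ | ⟨-, h, h'⟩
    · exact hu (h₁ ▸ h.2.1)
    · exact hu (h₁.trans h ▸ hC)
    · exact hne ⟨h₁.trans h, Or.inl (h₂.trans h')⟩
    · exact hu (h₁ ▸ h.2.2)
    · exact hne ⟨h₁.trans h', Or.inr (h₂.trans h)⟩
    · exact hu (h₁.trans h' ▸ hA)
  have hfin' : {x | g (x + (τ, 1)) ≠ 0}.Finite :=
    hfin.preimage (f := fun x => x + (τ, 1)) (add_left_injective _).injOn
  have hmove : ∀ x y, siteAdj x y → (y.1 = x.1 + σ ∨ y.2 = x.2 + 1) → x ∈ Vᶜ → y ∈ Vᶜ →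
      g (x + (τ, 1)) = g (y + (τ, 1)) := by
    intro x y hxy hdir hx hy
    have hxA : x ≠ A := fun h => hx (h ▸ hA)
    have hyA : y ≠ A := fun h => hy (h ▸ hA)
    rw [siteAdj_iff] at hxy
    refine hconst _ _ (by rw [siteAdj_iff]; simp; omega) fun i hi hs => ?_
    rcases hdir with hdir | hdir
    · refine hcross y (y + (0, 1)) (by rw [siteAdj_iff]; simp) hy ?_ i hi ?_
      all_goals
        simp only [Prod.ext_iff, Prod.fst_add, Prod.snd_add, ne_eq] at *
        omega
    · refine hcross y (y + (σ, 0)) (by rw [siteAdj_iff]; simp; omega) hy ?_ i hi ?_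
      all_goals
        simp only [Prod.ext_iff, Prod.fst_add, Prod.snd_add, ne_eq] at *
        omega
  have hc : ∀ x y, siteAdj x y → x ∈ Vᶜ → y ∈ Vᶜ → g (x + (τ, 1)) = g (y + (τ, 1)) := by
    intro x y hxy hx hy
    have hxy' := siteAdj_iff.1 hxy
    by_cases hdir : y.1 = x.1 + σ ∨ y.2 = x.2 + 1
    · exact hmove x y hxy hdir hx hy
    · exact (hmove y x (siteAdj_symm hxy) (by omega) hy hx).symm
  have hgB := eq_zero_of_infinite_siteComp (h := fun x => g (x + (τ, 1))) hfin' hc hB'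
  have hgD := eq_zero_of_infinite_siteComp (h := fun x => g (x + (τ, 1))) hfin' hc hD'
  have hDw : g (A + (0, 1) + (τ, 1)) = g (A + (τ, 1)) := by
    refine hconst _ _ (by rw [siteAdj_iff]; simp) fun i hi hs => ?_
    refine hcross (A + (0, 1)) (A + (σ, 1)) (by rw [siteAdj_iff]; simp; omega) hD ?_ i hi ?_
    all_goals
      simp only [Prod.ext_iff, Prod.fst_add, Prod.snd_add, ne_eq] at *
      omega
  refine hjump (A + (σ, 0) + (τ, 1)) (A + (τ, 1)) (by rw [siteAdj_iff]; simp; omega) n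
    (by omega) ?_ ?_ (hgB.trans (hgD.symm.trans hDw))
  · rcases hstep n (by omega) with h | ⟨-, h, h'⟩ | h
    · exact absurd h.2.2 (by simpa [γ] using hB)
    · rw [h, h']
      simp only [Prod.ext_iff, Prod.fst_add, Prod.snd_add]
      omega
    · omega
  · intro i hi hin hs
    have hs' : (A + (σ, 0)) + (A + (σ, 1)) = γ i + γ (i + 1) := by
      simp only [Prod.ext_iff, Prod.fst_add, Prod.snd_add] at *
      omega
    rcases eq_or_eq_of_add_eq_add (by rw [siteAdj_iff]; simp) (hwalk i hi) hs' with
        ⟨h₁, h₂⟩ | ⟨h₁, h₂⟩ <;>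
      rcases hstep i hi with h | ⟨h₀, h, h'⟩ | ⟨h₀, h, h'⟩
    · exact hB (h₁ ▸ h.2.1)
    · exact hin h₀
    · rw [h'] at h₂; simp [Prod.ext_iff] at h₂
    · exact hB (h₁ ▸ h.2.2)
    · exact hin h₀
    · rw [h'] at h₁; simp [Prod.ext_iff] at h₁; omega

theorem not_three_of_not_alternating {pA pB pC pD r u l d : Prop} (hr : r ↔ ¬ (pB ↔ pC))
    (hu : u ↔ ¬ (pD ↔ pC)) (hl : l ↔ ¬ (pA ↔ pD)) (hd : d ↔ ¬ (pA ↔ pB))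
    (hdiag : ¬ (pA ∧ pC ∧ ¬ pB ∧ ¬ pD)) (hanti : ¬ (pB ∧ pD ∧ ¬ pA ∧ ¬ pC)) :
    ¬ (r ∧ u ∧ l) ∧ ¬ (r ∧ u ∧ d) ∧ ¬ (r ∧ l ∧ d) ∧ ¬ (u ∧ l ∧ d) := by
  rw [hr, hu, hl, hd]
  by_cases pA <;> by_cases pB <;> by_cases pC <;> by_cases pD <;> simp_all

theorem not_one_of_cycle {pA pB pC pD r u l d : Prop} (hr : r ↔ ¬ (pB ↔ pC))
    (hu : u ↔ ¬ (pD ↔ pC)) (hl : l ↔ ¬ (pA ↔ pD)) (hd : d ↔ ¬ (pA ↔ pB)) :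
    ¬ (r ∧ ¬ u ∧ ¬ l ∧ ¬ d) ∧ ¬ (u ∧ ¬ r ∧ ¬ l ∧ ¬ d) ∧ ¬ (l ∧ ¬ r ∧ ¬ u ∧ ¬ d) ∧
      ¬ (d ∧ ¬ r ∧ ¬ u ∧ ¬ l) := by
  rw [hr, hu, hl, hd]
  by_cases pA <;> by_cases pB <;> by_cases pC <;> by_cases pD <;> simp [*]

/-- Every dual boundary edge at `a` has exactly one companion at `a`. -/
theorem exists_other_dualBdryAdj {V : Set (ℤ × ℤ)} (hconn : ∀ x ∈ V, ∀ y ∈ V, connIn V x y)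
    {a b : ℤ × ℤ} (hab : dualBdryAdj V a b) :
    ∃ c, c ≠ b ∧ dualBdryAdj V a c ∧ ∀ d, dualBdryAdj V a d → d = b ∨ d = c := by
  have adjBC : siteAdj (a + (1, 0)) (a + (1, 1)) := by rw [siteAdj_iff]; simp
  have adjDC : siteAdj (a + (0, 1)) (a + (1, 1)) := by rw [siteAdj_iff]; simp
  have adjAD : siteAdj a (a + (0, 1)) := by rw [siteAdj_iff]; simp
  have adjAB : siteAdj a (a + (1, 0)) := by rw [siteAdj_iff]; simp
  have adj_right : dualBdryAdj V a (a + (1, 0)) ↔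
      ¬ (a + (1, 0) ∈ clo V ↔ a + (1, 1) ∈ clo V) :=
    dualBdryAdj_iff (by rw [siteAdj_iff]; simp) adjBC (by ext <;> simp <;> ring)
  have adj_up : dualBdryAdj V a (a + (0, 1)) ↔
      ¬ (a + (0, 1) ∈ clo V ↔ a + (1, 1) ∈ clo V) :=
    dualBdryAdj_iff (by rw [siteAdj_iff]; simp) adjDC (by ext <;> simp <;> ring)
  have adj_left : dualBdryAdj V a (a + (-1, 0)) ↔ ¬ (a ∈ clo V ↔ a + (0, 1) ∈ clo V) :=
    dualBdryAdj_iff (by rw [siteAdj_iff]; simp; omega) adjAD (by ext <;> simp <;> ring)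
  have adj_down : dualBdryAdj V a (a + (0, -1)) ↔ ¬ (a ∈ clo V ↔ a + (1, 0) ∈ clo V) :=
    dualBdryAdj_iff (by rw [siteAdj_iff]; simp; omega) adjAB (by ext <;> simp <;> ring)
  have hnbr : ∀ d, dualBdryAdj V a d →
      d = a + (1, 0) ∨ d = a + (0, 1) ∨ d = a + (-1, 0) ∨ d = a + (0, -1) := by
    intro d hd
    have := siteAdj_iff.1 hd.1
    simp only [Prod.ext_iff, Prod.fst_add, Prod.snd_add]
    omega
  have hdiag : ¬ (a ∈ clo V ∧ a + (1, 1) ∈ clo V ∧ a + (1, 0) ∉ clo V ∧ a + (0, 1) ∉ clo V) := by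
    rintro ⟨hA, hC, hB, hD⟩
    have hB' := notMem_clo_iff.1 hB
    have hD' := notMem_clo_iff.1 hD
    exact not_alternating hconn (Or.inl ⟨rfl, rfl⟩) a (mem_of_mem_clo_of_siteAdj adjAB hA hB)
      (mem_of_mem_clo_of_siteAdj (siteAdj_symm adjBC) hC hB) hB'.1 hD'.1 hB'.2 hD'.2
  have hanti : ¬ (a + (1, 0) ∈ clo V ∧ a + (0, 1) ∈ clo V ∧ a ∉ clo V ∧ a + (1, 1) ∉ clo V) := by
    rintro ⟨hB, hD, hA, hC⟩
    have hA' := notMem_clo_iff.1 hA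
    have hC' := notMem_clo_iff.1 hC
    have eA : a + (1, 0) + (-1, 0) = a := by ext <;> simp
    have eC : a + (1, 0) + (0, 1) = a + (1, 1) := by ext <;> simp
    have eD : a + (1, 0) + (-1, 1) = a + (0, 1) := by ext <;> simp
    refine not_alternating hconn (Or.inr ⟨rfl, rfl⟩) (a + (1, 0))
      (mem_of_mem_clo_of_siteAdj adjBC hB hC) ?_ ?_ ?_ ?_ ?_
    · rw [eD]; exact mem_of_mem_clo_of_siteAdj adjDC hD hC
    · rw [eA]; exact hA'.1
    · rw [eC]; exact hC'.1
    · rw [eA]; exact hA'.2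
    · rw [eC]; exact hC'.2
  have n₁ : a + (1, 0) ≠ a + (0, 1) := by simp
  have n₂ : a + (1, 0) ≠ a + (-1, 0) := by simp
  have n₃ : a + (1, 0) ≠ a + (0, -1) := by simp
  have n₄ : a + (0, 1) ≠ a + (-1, 0) := by simp
  have n₅ : a + (0, 1) ≠ a + (0, -1) := by simp
  have n₆ : a + (-1, 0) ≠ a + (0, -1) := by simp
  obtain ⟨h_rul, h_rud, h_rld, h_uld⟩ :=
    not_three_of_not_alternating adj_right adj_up adj_left adj_down hdiag hanti
  obtain ⟨h_r, h_u, h_l, h_d⟩ := not_one_of_cycle adj_right adj_up adj_left adj_down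
  have hex : ∃ c, c ≠ b ∧ dualBdryAdj V a c := by
    by_contra! hnone
    rcases hnbr b hab with rfl | rfl | rfl | rfl
    · exact h_r ⟨hab, hnone _ n₁.symm, hnone _ n₂.symm, hnone _ n₃.symm⟩
    · exact h_u ⟨hab, hnone _ n₁, hnone _ n₄.symm, hnone _ n₅.symm⟩
    · exact h_l ⟨hab, hnone _ n₂, hnone _ n₄, hnone _ n₆.symm⟩
    · exact h_d ⟨hab, hnone _ n₃, hnone _ n₅, hnone _ n₆⟩
  obtain ⟨c, hcb, hac⟩ := hex
  refine ⟨c, hcb, hac, fun d had => ?_⟩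
  by_contra hne
  have hb := hnbr b hab
  have hc := hnbr c hac
  have hd := hnbr d had
  rcases hb with rfl | rfl | rfl | rfl <;> rcases hc with rfl | rfl | rfl | rfl <;>
    rcases hd with rfl | rfl | rfl | rfl <;>
    first
    | exact hcb rfl
    | exact hne (Or.inl rfl)
    | exact hne (Or.inr rfl)
    | exact h_rul ⟨by assumption, by assumption, by assumption⟩
    | exact h_rud ⟨by assumption, by assumption, by assumption⟩
    | exact h_rld ⟨by assumption, by assumption, by assumption⟩
    | exact h_uld ⟨by assumption, by assumption, by assumption⟩

/-- In a graph in which every edge at a vertex has exactly one companion there and which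
contains no circuit, every non-isolated vertex lies on a doubly-infinite injective path
carrying all the edges at its vertices. -/
theorem exists_biinfinite_path {α : Type*} {R : α → α → Prop} (hsymm : ∀ a b, R a b → R b a)
    (hirrefl : ∀ a, ¬ R a a)
    (hother : ∀ a b, R a b → ∃ c, c ≠ b ∧ R a c ∧ ∀ d, R a d → d = b ∨ d = c)
    (hcircuit : ¬ ∃ (k : ℕ) (γ : ℕ → α), 3 ≤ k ∧ (∀ i < k, R (γ i) (γ (i + 1))) ∧
      (∀ i j, i < j → j < k → γ i ≠ γ j) ∧ γ k = γ 0)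
    {a b : α} (hab : R a b) :
    ∃ γ : ℤ → α, Function.Injective γ ∧ γ 0 = a ∧ (∀ n : ℤ, R (γ n) (γ (n + 1))) ∧
      ∀ (n : ℤ) (b : α), R (γ n) b → b = γ (n + 1) ∨ b = γ (n - 1) := by
  choose o hne hadj honly using hother
  have hoo : ∀ a b (h : R a b), o a (o a b h) (hadj a b h) = b := by
    intro a b h
    exact ((honly a b h _ (hadj a _ _)).resolve_right (hne a _ _))
  let turn : Equiv.Perm {e : α × α // R e.1 e.2} :=
    Function.Involutive.toPerm (fun e => ⟨(e.1.1, o e.1.1 e.1.2 e.2), hadj _ _ _⟩) (by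
      rintro ⟨⟨a, b⟩, h⟩
      exact Subtype.ext (Prod.ext rfl (hoo a b h)))
  let flip : Equiv.Perm {e : α × α // R e.1 e.2} :=
    Function.Involutive.toPerm (fun e => ⟨(e.1.2, e.1.1), hsymm _ _ e.2⟩) (by
      rintro ⟨⟨a, b⟩, h⟩
      rfl)
  let T := turn * flip
  let E : ℤ → {e : α × α // R e.1 e.2} := fun n => (T ^ n) ⟨(a, b), hab⟩
  have hE : ∀ n, E (n + 1) = T (E n) := by
    intro n
    change (T ^ (n + 1)) _ = T ((T ^ n) _)
    rw [add_comm, zpow_add, zpow_one, Equiv.Perm.mul_apply]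
  let γ : ℤ → α := fun n => (E n).1.1
  have hγ : ∀ n, (E n).1.2 = γ (n + 1) := fun n => by
    change _ = (E (n + 1)).1.1
    rw [hE]; rfl
  have hR : ∀ n, R (γ n) (γ (n + 1)) := fun n => hγ n ▸ (E n).2
  have hnext : ∀ n, γ (n + 1 + 1) = o (γ (n + 1)) (γ n) (hsymm _ _ (hR n)) := by
    intro n
    rw [← hγ (n + 1), hE]
    change o (E n).1.2 (E n).1.1 _ = _
    congr 1
    exact hγ n
  refine ⟨γ, ?_, rfl, hR, ?_⟩
  · by_contra hinj
    have hrep : ∃ k : ℕ, 0 < k ∧ ∃ i : ℤ, γ (i + k) = γ i := by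
      simp only [Function.Injective, not_forall] at hinj
      obtain ⟨i, j, hij, hne⟩ := hinj
      rcases lt_or_gt_of_ne hne with h | h
      · refine ⟨(j - i).toNat, by omega, i, ?_⟩
        rw [Int.toNat_of_nonneg (by omega), add_sub_cancel, hij]
      · refine ⟨(i - j).toNat, by omega, j, ?_⟩
        rw [Int.toNat_of_nonneg (by omega), add_sub_cancel, hij]
    classical
    obtain ⟨hk, i, hi⟩ := Nat.find_spec hrep
    have hmin := fun m => Nat.find_min hrep (m := m)
    generalize Nat.find hrep = k at hk hi hmin
    have hk1 : k ≠ 1 := by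
      rintro rfl
      have := hR i
      rw [Nat.cast_one] at hi
      rw [hi] at this
      exact hirrefl _ this
    have hk2 : k ≠ 2 := by
      rintro rfl
      rw [show i + ((2 : ℕ) : ℤ) = i + 1 + 1 by push_cast; ring, hnext] at hi
      exact hne _ _ _ hi
    refine hcircuit ⟨k, fun m => γ (i + m), by omega, fun m _ => ?_, fun m m' hm hm' heq => ?_,
      by simpa using hi⟩
    · have := hR (i + m)
      rwa [add_assoc] at this
    · refine hmin (m' - m) (by omega) ⟨by omega, i + m, ?_⟩
      rw [show i + (m : ℤ) + ((m' - m : ℕ) : ℤ) = i + m' by omega]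
      exact heq.symm
  · intro n c hc
    obtain ⟨m, rfl⟩ : ∃ m, n = m + 1 := ⟨n - 1, by ring⟩
    rw [hnext, add_sub_cancel_right]
    exact (honly _ _ (hsymm _ _ (hR m)) c hc).symm

/-- **Lemma.** If `V ⊆ ℤ²` is site-connected and infinite, then the dual edge boundary
`B(V)` contains no vertex self-avoiding circuit; consequently `B(V)` is a vertex-disjoint
union of vertex self-avoiding doubly-infinite paths: every dual vertex incident to `B(V)`
lies on a doubly-infinite injective path whose steps are edges of `B(V)` and which
carries all edges of `B(V)` incident to its vertices. -/
theorem dual_boundary_no_circuit_union_of_biinfinite_paths (V : Set (ℤ × ℤ))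
    (hinf : V.Infinite) (hconn : ∀ x ∈ V, ∀ y ∈ V, connIn V x y) :
    (¬ ∃ (k : ℕ) (γ : ℕ → ℤ × ℤ), 3 ≤ k ∧
        (∀ i < k, dualBdryAdj V (γ i) (γ (i + 1))) ∧
        (∀ i j, i < j → j < k → γ i ≠ γ j) ∧ γ k = γ 0) ∧
    ∀ a : ℤ × ℤ, (∃ b, dualBdryAdj V a b) →
      ∃ γ : ℤ → ℤ × ℤ, Function.Injective γ ∧ γ 0 = a ∧
        (∀ n : ℤ, dualBdryAdj V (γ n) (γ (n + 1))) ∧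
        ∀ (n : ℤ) (b : ℤ × ℤ), dualBdryAdj V (γ n) b →
          b = γ (n + 1) ∨ b = γ (n - 1) := by
  refine ⟨not_exists_dualBdry_circuit hinf hconn, fun a hex => ?_⟩
  obtain ⟨b, hab⟩ := hex
  exact exists_biinfinite_path (fun _ _ => dualBdryAdj_symm)
    (fun a h => by simpa [siteAdj] using h.1) (fun _ _ => exists_other_dualBdryAdj hconn)
    (not_exists_dualBdry_circuit hinf hconn) hab
end
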